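/- Let n ≥ 2, let M_n : ℝⁿ → ℝ be a continuous symmetric function of polynomial growth, and let u : ℝ → 𝒮(ℝ) be a continuously differentiable curve of real-valued Schwartz functions solving the quartic KdV equation ∂_t u + ∂_x³u = ∂_x(u⁴). Then for every t ∈ ℝ, (d/dt) Λ_n(M_n; u(t)) = i·Λ_n(M_n·Φ_n; u(t)) + i·n·(2π)^{−3}·Λ_{n+3}( M_n(ξ₁,…,ξ_{n−1}, ξ_n+ξ_{n+1}+ξ_{n+2}+ξ_{n+3})·(ξ_n+ξ_{n+1}+ξ_{n+2}+ξ_{n+3}) ; u(t)), where Φ_n(ξ₁,…,ξ_n) = ξ₁³+⋯+ξ_n³. -/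

import Mathlib

open MeasureTheory

noncomputable section

/-- 1D Fourier transform  f̂(ξ) = ∫ e^{-ixξ} f(x) dx. -/
def FTs (f : ℝ → ℂ) (ξ : ℝ) : ℂ :=
  ∫ x : ℝ, Complex.exp (-(Complex.I * ((x * ξ : ℝ) : ℂ))) * f x

/-- Extend a vector of `n-1` frequencies to `n` frequencies summing to zero. -/
def padZero (n : ℕ) (v : Fin (n - 1) → ℝ) : Fin n → ℝ :=
  fun j => if h : (j : ℕ) < n - 1 then v ⟨j, h⟩ else -(∑ i, v i)

/-- Multilinear functional Λ_n(M; f) = ∫_{ξ₁+⋯+ξ_n=0} M ∏ f̂(ξ_j). -/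
def Lam (n : ℕ) (M : (Fin n → ℝ) → ℂ) (f : ℝ → ℂ) : ℂ :=
  ∫ v : Fin (n - 1) → ℝ, M (padZero n v) * ∏ j, FTs f (padZero n v j)

/-- Collapse `n+3` frequencies to `n` by summing the last four
(the multiplier `M_n(ξ₁,…,ξ_{n-1}, ξ_n+⋯+ξ_{n+3})`). -/
def collapse (n : ℕ) (ξ : Fin (n + 3) → ℝ) : Fin n → ℝ := fun j =>
  if (j : ℕ) < n - 1 then ξ (Fin.castLE (Nat.le_add_right n 3) j)
  else ξ ⟨n - 1, by omega⟩ + ξ ⟨n, by omega⟩ + ξ ⟨n + 1, by omega⟩ + ξ ⟨n + 2, by omega⟩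

open SchwartzMap FourierTransform

/-- Complexification of a real-valued Schwartz function. -/
def complexify : 𝓢(ℝ, ℝ) →L[ℝ] 𝓢(ℝ, ℂ) := SchwartzMap.postcompCLM Complex.ofRealCLM

lemma complexify_apply (f : 𝓢(ℝ, ℝ)) (x : ℝ) : complexify f x = (f x : ℂ) := rfl

/-- The Fourier transform with the kernel `exp (-i x ξ)` as a continuous linear map on
Schwartz space. -/
def schwartzFTs : 𝓢(ℝ, ℂ) →L[ℝ] 𝓢(ℝ, ℂ) :=
  (SchwartzMap.compCLMOfContinuousLinearEquiv ℝ
    (ContinuousLinearEquiv.smulLeft (Units.mk0 (2 * Real.pi)⁻¹ (by positivity)))).comp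
    (fourierCLM ℝ 𝓢(ℝ, ℂ))

lemma schwartzFTs_apply_eq_fourier (f : 𝓢(ℝ, ℂ)) (ξ : ℝ) :
    schwartzFTs f ξ = 𝓕 (f : ℝ → ℂ) ((2 * Real.pi)⁻¹ * ξ) := by
  rfl

lemma schwartzFTs_apply (f : 𝓢(ℝ, ℂ)) (ξ : ℝ) : schwartzFTs f ξ = FTs f ξ := by
  rw [schwartzFTs_apply_eq_fourier, Real.fourier_eq', FTs]
  congr 1
  ext x
  rw [smul_eq_mul]
  congr 2
  simp only [RCLike.inner_apply, conj_trivial]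
  push_cast
  have : (Real.pi : ℂ) ≠ 0 := by exact_mod_cast Real.pi_ne_zero
  field_simp

lemma schwartzFTs_deriv (f : 𝓢(ℝ, ℂ)) (ξ : ℝ) :
    schwartzFTs (SchwartzMap.derivCLM ℝ ℂ f) ξ = Complex.I * ξ * schwartzFTs f ξ := by
  have h := congrFun (Real.fourier_deriv f.integrable f.differentiable
    (SchwartzMap.derivCLM ℝ ℂ f).integrable) ((2 * Real.pi)⁻¹ * ξ)
  rw [schwartzFTs_apply_eq_fourier, schwartzFTs_apply_eq_fourier]
  refine Eq.trans h ?_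
  rw [smul_eq_mul]
  congr 1
  push_cast
  have : (Real.pi : ℂ) ≠ 0 := by exact_mod_cast Real.pi_ne_zero
  field_simp

lemma schwartzFTs_mul (f g : 𝓢(ℝ, ℂ)) (ξ : ℝ) :
    schwartzFTs (SchwartzMap.pairing (ContinuousLinearMap.mul ℂ ℂ) f g) ξ =
      ((2 * Real.pi)⁻¹ : ℝ) * ∫ η, schwartzFTs f η * schwartzFTs g (ξ - η) := by
  have key : ∀ ζ : ℝ, 𝓕 (SchwartzMap.pairing (ContinuousLinearMap.mul ℂ ℂ) f g : ℝ → ℂ) ζ =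
      ∫ η, 𝓕 (f : ℝ → ℂ) η * 𝓕 (g : ℝ → ℂ) (ζ - η) := by
    intro ζ
    have h := SchwartzMap.convolution_apply (ContinuousLinearMap.mul ℂ ℂ) (𝓕⁻ f) (𝓕⁻ g) (-ζ)
    have h2 : SchwartzMap.convolution (ContinuousLinearMap.mul ℂ ℂ) (𝓕⁻ f) (𝓕⁻ g) =
        𝓕⁻ (SchwartzMap.pairing (ContinuousLinearMap.mul ℂ ℂ) f g) := by
      simp [SchwartzMap.convolution]
    rw [h2, SchwartzMap.fourierInv_coe, Real.fourierInv_eq_fourier_neg, neg_neg] at h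
    rw [h, MeasureTheory.convolution_def, ← MeasureTheory.integral_neg_eq_self]
    congr 1
    ext η
    simp only [ContinuousLinearMap.mul_apply', SchwartzMap.fourierInv_coe,
      Real.fourierInv_eq_fourier_neg, neg_neg]
    rw [show -(-ζ - -η) = ζ - η by ring]
  rw [schwartzFTs_apply_eq_fourier, key]
  have := MeasureTheory.Measure.integral_comp_mul_left (fun η =>
    𝓕 (f : ℝ → ℂ) η * 𝓕 (g : ℝ → ℂ) ((2 * Real.pi)⁻¹ * ξ - η)) ((2 * Real.pi)⁻¹)
  simp only [schwartzFTs_apply_eq_fourier, mul_sub]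
  rw [this, ← Complex.real_smul, smul_smul]
  rw [abs_of_pos (by positivity), mul_inv_cancel₀ (by positivity), one_smul]

lemma complexify_derivCLM (f : 𝓢(ℝ, ℝ)) :
    complexify (SchwartzMap.derivCLM ℝ ℝ f) = SchwartzMap.derivCLM ℝ ℂ (complexify f) := by
  ext x
  rw [complexify_apply, SchwartzMap.derivCLM_apply, SchwartzMap.derivCLM_apply]
  exact (f.differentiableAt.hasDerivAt.ofReal_comp).deriv.symm

/-- The powers `f ^ (k + 1)` of a Schwartz function. -/
def schwartzPow (f : 𝓢(ℝ, ℂ)) : ℕ → 𝓢(ℝ, ℂ)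
  | 0 => f
  | k + 1 => SchwartzMap.pairing (ContinuousLinearMap.mul ℂ ℂ) f (schwartzPow f k)

lemma schwartzPow_apply (f : 𝓢(ℝ, ℂ)) (k : ℕ) (x : ℝ) : schwartzPow f k x = f x ^ (k + 1) := by
  induction k with
  | zero => simp [schwartzPow]
  | succ k ih => simp [schwartzPow, ih, pow_succ']

lemma schwartzFTs_of_quarticKdV {f df : 𝓢(ℝ, ℝ)}
    (h : ∀ x : ℝ, df x + iteratedDeriv 3 f x = deriv (fun y => f y ^ 4) x) (ξ : ℝ) :
    schwartzFTs (complexify df) ξ = Complex.I * ξ ^ 3 * schwartzFTs (complexify f) ξ +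
      Complex.I * ξ * schwartzFTs (schwartzPow (complexify f) 3) ξ := by
  have hdf : complexify df = SchwartzMap.derivCLM ℝ ℂ (schwartzPow (complexify f) 3) -
      SchwartzMap.derivCLM ℝ ℂ (SchwartzMap.derivCLM ℝ ℂ
        (SchwartzMap.derivCLM ℝ ℂ (complexify f))) := by
    rw [← complexify_derivCLM, ← complexify_derivCLM, ← complexify_derivCLM]
    ext x
    have h1 : deriv (schwartzPow (complexify f) 3) x = (deriv (fun y => f y ^ 4) x : ℝ) := by
      have : (schwartzPow (complexify f) 3 : ℝ → ℂ) = fun y => ((f y ^ 4 : ℝ) : ℂ) := by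
        ext y
        simp [schwartzPow_apply, complexify_apply]
      rw [this]
      exact ((f.differentiableAt (x := x)).pow 4).hasDerivAt.ofReal_comp.deriv
    rw [sub_apply, SchwartzMap.derivCLM_apply, h1, complexify_apply, complexify_apply,
      ← h x]
    have h3 : iteratedDeriv 3 f x = SchwartzMap.derivCLM ℝ ℝ (SchwartzMap.derivCLM ℝ ℝ
        (SchwartzMap.derivCLM ℝ ℝ f)) x := by
      simp only [iteratedDeriv_succ, iteratedDeriv_zero]
      rfl
    rw [h3]
    push_cast
    ring
  rw [hdf, map_sub, sub_apply]
  simp only [schwartzFTs_deriv]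
  linear_combination (-Complex.I * ξ ^ 3 * schwartzFTs (complexify f) ξ) * Complex.I_sq

lemma padZero_castSucc {m : ℕ} (v : Fin m → ℝ) (j : Fin m) :
    padZero (m + 1) v j.castSucc = v j := by
  simp [padZero]

lemma padZero_last {m : ℕ} (v : Fin m → ℝ) :
    padZero (m + 1) v (Fin.last m) = -∑ i, v i := by
  simp [padZero]

lemma sum_padZero {m : ℕ} (v : Fin m → ℝ) : ∑ j, padZero (m + 1) v j = 0 := by
  simp [Fin.sum_univ_castSucc, padZero_castSucc, padZero_last]

lemma continuous_padZero (m : ℕ) : Continuous (padZero (m + 1)) := by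
  refine continuous_pi fun j => ?_
  refine Fin.lastCases ?_ (fun j => ?_) j
  · simp only [padZero_last]
    fun_prop
  · simp only [padZero_castSucc]
    fun_prop

lemma one_add_sum_le_prod_one_add_fin {m : ℕ} (a : Fin m → ℝ) (ha : ∀ j, 0 ≤ a j) :
    1 + ∑ j, a j ≤ ∏ j, (1 + a j) := by
  induction m with
  | zero => simp
  | succ m ih =>
    rw [Fin.sum_univ_castSucc, Fin.prod_univ_castSucc]
    have h := ih (fun j => a j.castSucc) (fun j => ha _)
    have h0 : 0 ≤ ∑ j : Fin m, a j.castSucc := Finset.sum_nonneg fun j _ => ha _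
    nlinarith [ha (Fin.last m)]

lemma one_add_norm_padZero_le {m : ℕ} (v : Fin m → ℝ) :
    1 + ‖padZero (m + 1) v‖ ≤ ∏ j, (1 + |v j|) := by
  refine le_trans ?_ (one_add_sum_le_prod_one_add_fin _ fun j => abs_nonneg (v j))
  gcongr
  rw [pi_norm_le_iff_of_nonneg (Finset.sum_nonneg fun j _ => abs_nonneg (v j))]
  refine Fin.lastCases ?_ (fun j => ?_)
  · rw [padZero_last, norm_neg]
    exact Finset.abs_sum_le_sum_abs _ _
  · rw [padZero_castSucc]
    exact Finset.single_le_sum (f := fun j => |v j|) (fun j _ => abs_nonneg (v j))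
      (Finset.mem_univ j)

lemma integrable_prod_inv_one_add_sq (m : ℕ) :
    Integrable (fun v : Fin m → ℝ => ∏ j, ((1 + |v j|) ^ 2)⁻¹) := by
  refine Integrable.fintype_prod (f := fun _ x => ((1 + |x|) ^ 2)⁻¹) fun _ => ?_
  refine (integrable_one_add_norm (E := ℝ) (μ := volume) (r := 2) (by simp)).congr ?_
  filter_upwards with x
  rw [Real.rpow_neg (by positivity)]
  norm_cast

lemma norm_mul_prod_le {m p : ℕ} {N : (Fin (m + 1) → ℝ) → ℂ} {C B : ℝ} {f : Fin m → ℝ → ℂ}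
    (hN : ∀ ξ, ‖N ξ‖ ≤ C * (1 + ‖ξ‖) ^ p)
    (hf : ∀ j x, (1 + |x|) ^ (p + 2) * ‖f j x‖ ≤ B) (v : Fin m → ℝ) :
    ‖N (padZero (m + 1) v) * ∏ j, f j (v j)‖ ≤ C * B ^ m * ∏ j, ((1 + |v j|) ^ 2)⁻¹ := by
  have hC : 0 ≤ C := by simpa using (norm_nonneg _).trans (hN 0)
  have h1 : ∏ j, ‖f j (v j)‖ ≤ ∏ j, (B * ((1 + |v j|) ^ (p + 2))⁻¹) := by
    refine Finset.prod_le_prod (fun _ _ => norm_nonneg _) fun j _ => ?_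
    rw [← div_eq_mul_inv, le_div_iff₀ (by positivity), mul_comm]
    exact hf j (v j)
  have h2 : ‖N (padZero (m + 1) v)‖ ≤ C * (∏ j, (1 + |v j|)) ^ p := by
    refine (hN _).trans ?_
    gcongr
    exact one_add_norm_padZero_le v
  have hP : 0 < ∏ j, (1 + |v j|) := Finset.prod_pos fun j _ => by positivity
  rw [norm_mul, norm_prod]
  refine (mul_le_mul h2 h1 (Finset.prod_nonneg fun _ _ => norm_nonneg _)
    (by positivity)).trans_eq ?_
  rw [Finset.prod_mul_distrib, Finset.prod_inv_distrib, Finset.prod_inv_distrib,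
    Finset.prod_pow, Finset.prod_pow, Finset.prod_const, Finset.card_univ, Fintype.card_fin,
    pow_add]
  field_simp

lemma norm_mul_prod_padZero_le {m p : ℕ} {N : (Fin (m + 1) → ℝ) → ℂ} {C B : ℝ}
    {f : Fin (m + 1) → ℝ → ℂ} (hN : ∀ ξ, ‖N ξ‖ ≤ C * (1 + ‖ξ‖) ^ p)
    (hf : ∀ j x, (1 + |x|) ^ (p + 2) * ‖f j x‖ ≤ B) (v : Fin m → ℝ) :
    ‖N (padZero (m + 1) v) * ∏ j, f j (padZero (m + 1) v j)‖ ≤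
      C * B ^ (m + 1) * ∏ j, ((1 + |v j|) ^ 2)⁻¹ := by
  have h1 := norm_mul_prod_le hN (fun j => hf j.castSucc) v
  have h2 : ‖f (Fin.last m) (-∑ i, v i)‖ ≤ B :=
    (le_mul_of_one_le_left (norm_nonneg _) (one_le_pow₀ (by simp))).trans (hf _ _)
  simp only [Fin.prod_univ_castSucc, padZero_castSucc, padZero_last, ← mul_assoc]
  rw [norm_mul]
  refine (mul_le_mul h1 h2 (norm_nonneg _) ((norm_nonneg _).trans h1)).trans_eq ?_
  ring

lemma exists_forall_one_add_pow_mul_le {K : Set ℝ} (hK : IsCompact K) {F : ℝ → 𝓢(ℝ, ℂ)}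
    (hF : Continuous F) (k : ℕ) :
    ∃ B, ∀ τ ∈ K, ∀ x, (1 + |x|) ^ k * ‖F τ x‖ ≤ B := by
  have hcont : Continuous fun τ => 2 ^ k * ((Finset.Iic (k, 0)).sup
      (fun m => SchwartzMap.seminorm ℝ m.1 m.2)) (F τ) := by
    refine continuous_const.mul (Continuous.comp ?_ hF)
    exact (schwartz_withSeminorms ℝ ℝ ℂ).finset_sups.continuous_seminorm (Finset.Iic (k, 0))
  obtain ⟨B, hB⟩ := hK.exists_bound_of_continuousOn hcont.continuousOn
  refine ⟨B, fun τ hτ x => ?_⟩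
  have := SchwartzMap.one_add_le_sup_seminorm_apply (𝕜 := ℝ) (m := (k, 0)) (k := k) (n := 0)
    le_rfl le_rfl (F τ) x
  rw [norm_iteratedFDeriv_zero] at this
  exact this.trans ((le_abs_self _).trans (hB τ hτ))

lemma exists_forall_schwartz_le {ι : Type*} [Finite ι] (f : ι → 𝓢(ℝ, ℂ)) (k : ℕ) :
    ∃ B, ∀ j x, (1 + |x|) ^ k * ‖f j x‖ ≤ B := by
  have h : ∀ j, ∃ B, ∀ x, (1 + |x|) ^ k * ‖f j x‖ ≤ B := fun j => by
    obtain ⟨B, hB⟩ := exists_forall_one_add_pow_mul_le (isCompact_singleton (x := (0 : ℝ)))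
      (continuous_const (y := f j)) k
    exact ⟨B, hB 0 rfl⟩
  choose B hB using h
  obtain ⟨B', hB'⟩ := Set.finite_range B |>.bddAbove
  exact ⟨B', fun j x => (hB j x).trans (hB' ⟨j, rfl⟩)⟩

lemma integrable_mul_prod {m p : ℕ} {N : (Fin (m + 1) → ℝ) → ℂ} {C : ℝ} (hNc : Continuous N)
    (hN : ∀ ξ, ‖N ξ‖ ≤ C * (1 + ‖ξ‖) ^ p) (f : Fin m → 𝓢(ℝ, ℂ)) :
    Integrable fun v : Fin m → ℝ => N (padZero (m + 1) v) * ∏ j, f j (v j) := by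
  obtain ⟨B, hB⟩ := exists_forall_schwartz_le f (p + 2)
  have hpad := continuous_padZero m
  refine ((integrable_prod_inv_one_add_sq m).const_mul (C * B ^ m)).mono' ?_
    (Filter.Eventually.of_forall fun v => norm_mul_prod_le hN hB v)
  refine Continuous.aestronglyMeasurable ?_
  exact (hNc.comp hpad).mul
    (continuous_finsetProd _ fun j _ => (f j).continuous.comp (continuous_apply j))

lemma continuous_mul_prod_padZero {m : ℕ} {N : (Fin (m + 1) → ℝ) → ℂ} (hNc : Continuous N)
    (f : Fin (m + 1) → 𝓢(ℝ, ℂ)) :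
    Continuous fun v : Fin m → ℝ =>
      N (padZero (m + 1) v) * ∏ j, f j (padZero (m + 1) v j) :=
  (hNc.comp (continuous_padZero m)).mul (continuous_finsetProd _ fun j _ =>
    (f j).continuous.comp ((continuous_apply j).comp (continuous_padZero m)))

lemma integrable_mul_prod_padZero {m p : ℕ} {N : (Fin (m + 1) → ℝ) → ℂ} {C : ℝ}
    (hNc : Continuous N) (hN : ∀ ξ, ‖N ξ‖ ≤ C * (1 + ‖ξ‖) ^ p) (f : Fin (m + 1) → 𝓢(ℝ, ℂ)) :
    Integrable fun v : Fin m → ℝ =>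
      N (padZero (m + 1) v) * ∏ j, f j (padZero (m + 1) v j) := by
  obtain ⟨B, hB⟩ := exists_forall_schwartz_le f (p + 2)
  exact ((integrable_prod_inv_one_add_sq m).const_mul (C * B ^ (m + 1))).mono'
    (continuous_mul_prod_padZero hNc f).aestronglyMeasurable
    (Filter.Eventually.of_forall fun v => norm_mul_prod_padZero_le hN hB v)

lemma hasDerivAt_integral_mul_prod_padZero {m p : ℕ} {N : (Fin (m + 1) → ℝ) → ℂ} {C : ℝ}
    (hNc : Continuous N) (hN : ∀ ξ, ‖N ξ‖ ≤ C * (1 + ‖ξ‖) ^ p) {F dF : ℝ → 𝓢(ℝ, ℂ)}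
    (hF : Continuous F) (hdF : Continuous dF)
    (hderiv : ∀ t x, HasDerivAt (fun τ => F τ x) (dF t x) t) (t : ℝ) :
    HasDerivAt
      (fun τ => ∫ v : Fin m → ℝ, N (padZero (m + 1) v) * ∏ j, F τ (padZero (m + 1) v j))
      (∑ i, ∫ v : Fin m → ℝ, N (padZero (m + 1) v) *
        ∏ j, (if j = i then dF t else F t) (padZero (m + 1) v j)) t := by
  have hK : IsCompact (Metric.closedBall t 1) := isCompact_closedBall t 1
  obtain ⟨B₁, hB₁⟩ := exists_forall_one_add_pow_mul_le hK hF (p + 2)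
  obtain ⟨B₂, hB₂⟩ := exists_forall_one_add_pow_mul_le hK hdF (p + 2)
  have hB : ∀ τ ∈ Metric.closedBall t 1, ∀ i j : Fin (m + 1), ∀ x,
      (1 + |x|) ^ (p + 2) * ‖(if j = i then dF τ else F τ) x‖ ≤ max B₁ B₂ := by
    intro τ hτ i j x
    split_ifs
    · exact (hB₂ τ hτ x).trans (le_max_right _ _)
    · exact (hB₁ τ hτ x).trans (le_max_left _ _)
  rw [← integral_finsetSum _ fun i _ => integrable_mul_prod_padZero hNc hN _]
  refine (hasDerivAt_integral_of_dominated_loc_of_deriv_le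
    (F' := fun τ (v : Fin m → ℝ) => ∑ i, N (padZero (m + 1) v) *
      ∏ j, (if j = i then dF τ else F τ) (padZero (m + 1) v j))
    (bound := fun v => ∑ _i : Fin (m + 1),
      C * max B₁ B₂ ^ (m + 1) * ∏ j, ((1 + |v j|) ^ 2)⁻¹)
    (Metric.closedBall_mem_nhds t one_pos) ?_ ?_ ?_ ?_ ?_ ?_).2
  · exact Filter.Eventually.of_forall fun τ =>
      (continuous_mul_prod_padZero hNc fun _ => F τ).aestronglyMeasurable
  · exact integrable_mul_prod_padZero hNc hN fun _ => F t
  · exact (continuous_finsetSum _ fun i _ =>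
      continuous_mul_prod_padZero hNc _).aestronglyMeasurable
  · refine Filter.Eventually.of_forall fun v τ hτ => ?_
    refine (norm_sum_le _ _).trans (Finset.sum_le_sum fun i _ => ?_)
    exact norm_mul_prod_padZero_le hN (f := fun j => ((if j = i then dF τ else F τ : 𝓢(ℝ, ℂ)) : ℝ → ℂ))
      (fun j x => hB τ hτ i j x) v
  · exact integrable_finsetSum _ fun i _ => (integrable_prod_inv_one_add_sq m).const_mul _
  · refine Filter.Eventually.of_forall fun v τ _ => ?_
    have h := (HasDerivAt.fun_finsetProd (u := Finset.univ) fun j _ =>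
      hderiv τ (padZero (m + 1) v j)).const_mul (N (padZero (m + 1) v))
    refine h.congr_deriv ?_
    rw [Finset.mul_sum]
    refine Finset.sum_congr rfl fun i _ => ?_
    rw [← Finset.mul_prod_erase _ _ (Finset.mem_univ i), if_pos rfl, smul_eq_mul, mul_comm (dF τ _)]
    congr 2
    refine Finset.prod_congr rfl fun j hj => ?_
    rw [if_neg (Finset.ne_of_mem_erase hj)]

/-- Restriction of a coordinate permutation to the hyperplane `∑ ξ_j = 0`, in the coordinates
given by `padZero`. -/
def hyperplanePerm {m : ℕ} (σ : Equiv.Perm (Fin (m + 1))) : (Fin m → ℝ) →ₗ[ℝ] (Fin m → ℝ) where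
  toFun v j := padZero (m + 1) v (σ j.castSucc)
  map_add' v w := by
    ext j
    rw [Pi.add_apply]
    refine Fin.lastCases ?_ (fun j => ?_) (σ j.castSucc)
    · simp only [padZero_last, Pi.add_apply, Finset.sum_add_distrib]
      ring
    · simp only [padZero_castSucc, Pi.add_apply]
  map_smul' c v := by
    ext j
    rw [Pi.smul_apply]
    refine Fin.lastCases ?_ (fun j => ?_) (σ j.castSucc)
    · simp [padZero_last, Finset.mul_sum]
    · simp [padZero_castSucc]

lemma padZero_hyperplanePerm {m : ℕ} (σ : Equiv.Perm (Fin (m + 1))) (v : Fin m → ℝ) :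
    padZero (m + 1) (hyperplanePerm σ v) = padZero (m + 1) v ∘ σ := by
  ext j
  refine Fin.lastCases ?_ (fun j => ?_) j
  · have h := Equiv.sum_comp σ (padZero (m + 1) v)
    rw [sum_padZero, Fin.sum_univ_castSucc] at h
    rw [padZero_last]
    change -∑ i : Fin m, padZero (m + 1) v (σ i.castSucc) = padZero (m + 1) v (σ (Fin.last m))
    linarith
  · rw [padZero_castSucc]
    rfl

lemma integral_padZero_comp_perm {m : ℕ} {σ : Equiv.Perm (Fin (m + 1))}
    (hσ : Function.Involutive σ) (h : (Fin (m + 1) → ℝ) → ℂ) :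
    ∫ v : Fin m → ℝ, h (padZero (m + 1) v ∘ σ) = ∫ v : Fin m → ℝ, h (padZero (m + 1) v) := by
  have hinv : Function.Involutive (hyperplanePerm σ) := fun v => by
    ext j
    change padZero (m + 1) (hyperplanePerm σ v) (σ j.castSucc) = v j
    rw [padZero_hyperplanePerm, Function.comp_apply, hσ, padZero_castSucc]
  have hdet : |LinearMap.det (hyperplanePerm σ)| = 1 := by
    have h1 : hyperplanePerm σ * hyperplanePerm σ = 1 := LinearMap.ext hinv
    have h2 := congrArg LinearMap.det h1
    rw [map_mul, map_one, ← abs_mul_abs_self] at h2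
    nlinarith [abs_nonneg (LinearMap.det (hyperplanePerm σ))]
  have hmap : Measure.map (hyperplanePerm σ) volume = volume := by
    rw [Measure.map_linearMap_addHaar_eq_smul_addHaar _ (abs_pos.1 (hdet ▸ one_pos)), abs_inv,
      hdet]
    simp
  have hemb : MeasurableEmbedding (hyperplanePerm σ) :=
    (LinearEquiv.ofInvolutive _ hinv).toContinuousLinearEquiv.toHomeomorph.measurableEmbedding
  conv_rhs => rw [← hmap, hemb.integral_map]
  simp only [padZero_hyperplanePerm]

lemma integral_mul_prod_slot_eq_last {m : ℕ} {M : (Fin (m + 1) → ℝ) → ℝ}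
    (hM : ∀ (σ : Equiv.Perm (Fin (m + 1))) (ξ : Fin (m + 1) → ℝ), M (ξ ∘ σ) = M ξ)
    (F G : ℝ → ℂ) (i : Fin (m + 1)) :
    ∫ v : Fin m → ℝ, ((M (padZero (m + 1) v) * padZero (m + 1) v i : ℝ) : ℂ) *
        ∏ j, (if j = i then G else F) (padZero (m + 1) v j) =
      ∫ v : Fin m → ℝ,
        ((M (padZero (m + 1) v) * padZero (m + 1) v (Fin.last m) : ℝ) : ℂ) *
        ∏ j, (if j = Fin.last m then G else F) (padZero (m + 1) v j) := by
  set σ := Equiv.swap i (Fin.last m) with hσ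
  rw [← integral_padZero_comp_perm (σ := σ) (fun j => Equiv.swap_apply_self i (Fin.last m) j)
    (fun ξ => ((M ξ * ξ (Fin.last m) : ℝ) : ℂ) *
      ∏ j, (if j = Fin.last m then G else F) (ξ j))]
  refine integral_congr_ae (Filter.Eventually.of_forall fun v => ?_)
  simp only [hM, Function.comp_apply]
  rw [hσ, Equiv.swap_apply_right]
  congr 1
  rw [← Equiv.prod_comp σ]
  refine Finset.prod_congr rfl fun j _ => ?_
  have : σ j = i ↔ j = Fin.last m := by
    rw [hσ, Equiv.swap_apply_eq_iff, Equiv.swap_apply_left]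
  simp only [this]
  rfl

section Fubini

variable {m : ℕ}

lemma integrable_init_mul_last {A : (Fin m → ℝ) → ℂ} (hA : Integrable A) {f : ℝ → ℂ}
    (hf : Integrable f) :
    Integrable fun w : Fin (m + 1) → ℝ => A (fun j => w j.castSucc) * f (w (Fin.last m)) := by
  have h := (volume_preserving_piFinSuccAbove (fun _ : Fin (m + 1) => ℝ)
    (Fin.last m)).integrable_comp_of_integrable (hf.mul_prod hA)
  refine h.congr (Filter.Eventually.of_forall fun w => ?_)
  simp [MeasurableEquiv.piFinSuccAbove, Fin.insertNthEquiv, mul_comm]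
  exact Or.inl rfl

lemma integral_init_last {h : (Fin m → ℝ) → ℝ → ℂ}
    (hh : Integrable fun w : Fin (m + 1) → ℝ => h (fun j => w j.castSucc) (w (Fin.last m))) :
    ∫ w : Fin (m + 1) → ℝ, h (fun j => w j.castSucc) (w (Fin.last m)) =
      ∫ v : Fin m → ℝ, ∫ y : ℝ, h v y := by
  have hp := (volume_preserving_piFinSuccAbove (fun _ : Fin (m + 1) => ℝ) (Fin.last m))
  have heq : (fun w : Fin (m + 1) → ℝ => h (fun j => w j.castSucc) (w (Fin.last m))) =
      (fun q : ℝ × (Fin m → ℝ) => h q.2 q.1) ∘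
        MeasurableEquiv.piFinSuccAbove (fun _ : Fin (m + 1) => ℝ) (Fin.last m) := by
    ext w
    simp [MeasurableEquiv.piFinSuccAbove, Fin.insertNthEquiv]
    rfl
  rw [heq] at hh ⊢
  rw [hp.integrable_comp_emb (MeasurableEquiv.measurableEmbedding _)] at hh
  have := hp.integral_comp (MeasurableEquiv.measurableEmbedding _)
    (fun q : ℝ × (Fin m → ℝ) => h q.2 q.1)
  refine this.trans ?_
  exact integral_prod_symm _ hh

lemma integral_mul_schwartzFTs_mul {A : (Fin m → ℝ) → ℂ} (hA : Integrable A) (f g : 𝓢(ℝ, ℂ)) :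
    ∫ v, A v * schwartzFTs (SchwartzMap.pairing (ContinuousLinearMap.mul ℂ ℂ) f g) (-∑ i, v i) =
      ((2 * Real.pi)⁻¹ : ℝ) * ∫ w : Fin (m + 1) → ℝ,
        (A (fun j => w j.castSucc) * schwartzFTs f (w (Fin.last m))) *
          schwartzFTs g (-∑ i, w i) := by
  have hsum : ∀ w : Fin (m + 1) → ℝ, -∑ i, w i = -∑ i : Fin m, w i.castSucc - w (Fin.last m) := by
    intro w
    rw [Fin.sum_univ_castSucc]
    ring
  simp only [hsum]
  rw [integral_init_last (h := fun v y => A v * schwartzFTs f y * schwartzFTs g (-∑ i, v i - y)),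
    ← integral_const_mul]
  · refine integral_congr_ae (Filter.Eventually.of_forall fun v => ?_)
    simp only [schwartzFTs_mul, mul_assoc, integral_const_mul]
    ring
  · obtain ⟨B, hB⟩ := exists_forall_schwartz_le (fun _ : Unit => schwartzFTs g) 0
    refine (integrable_init_mul_last hA (schwartzFTs f).integrable).mul_bdd (c := B) ?_ ?_
    · exact ((schwartzFTs g).continuous.comp (by fun_prop)).aestronglyMeasurable
    · exact Filter.Eventually.of_forall fun w => by simpa using hB () _

end Fubini

lemma continuous_of_tendsto_slope {E : Type*} [AddCommGroup E] [Module ℝ E] [TopologicalSpace E]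
    [IsTopologicalAddGroup E] [ContinuousSMul ℝ E] {u du : ℝ → E}
    (h : ∀ t : ℝ, Filter.Tendsto (fun h : ℝ => h⁻¹ • (u (t + h) - u t))
      (nhdsWithin 0 {0}ᶜ) (nhds (du t))) : Continuous u := by
  refine continuous_iff_continuousAt.2 fun t => ?_
  have hid : Filter.Tendsto (fun h : ℝ => h) (nhdsWithin 0 {0}ᶜ) (nhds 0) :=
    tendsto_nhdsWithin_of_tendsto_nhds Filter.tendsto_id
  have h1 := (hid.smul (h t)).add_const (u t)
  rw [zero_smul, zero_add] at h1
  have h2 : ContinuousAt (fun h : ℝ => u (t + h)) 0 := by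
    rw [continuousAt_iff_punctured_nhds, add_zero]
    refine h1.congr' ?_
    filter_upwards [self_mem_nhdsWithin] with y hy
    rw [smul_inv_smul₀ hy, sub_add_cancel]
  have h3 : ContinuousAt (fun s : ℝ => s - t) t := by fun_prop
  have h4 := ContinuousAt.comp (f := fun s : ℝ => s - t) (x := t)
    (g := fun h : ℝ => u (t + h)) (by simpa using h2) h3
  simpa [Function.comp_def] using h4

lemma hasDerivAt_schwartz_apply {G : 𝓢(ℝ, ℝ) →L[ℝ] 𝓢(ℝ, ℂ)} {u : ℝ → 𝓢(ℝ, ℝ)} {du : 𝓢(ℝ, ℝ)}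
    {t : ℝ} (h : Filter.Tendsto (fun h : ℝ => h⁻¹ • (u (t + h) - u t))
      (nhdsWithin 0 {0}ᶜ) (nhds du)) (x : ℝ) :
    HasDerivAt (fun τ => G (u τ) x) (G du x) t := by
  rw [hasDerivAt_iff_tendsto_slope_zero]
  have hc : Continuous fun f : 𝓢(ℝ, ℝ) => G f x :=
    (BoundedContinuousFunction.evalCLM ℝ x).continuous.comp
      ((SchwartzMap.toBoundedContinuousFunctionCLM ℝ ℝ ℂ).continuous.comp G.continuous)
  refine ((hc.tendsto du).comp h).congr fun y => ?_
  simp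

lemma norm_mul_pow_le {m p k : ℕ} {M : (Fin (m + 1) → ℝ) → ℝ} {C : ℝ}
    (hM : ∀ ξ, |M ξ| ≤ C * (1 + ‖ξ‖) ^ p) (i : Fin (m + 1)) (ξ : Fin (m + 1) → ℝ) :
    ‖((M ξ * ξ i ^ k : ℝ) : ℂ)‖ ≤ C * (1 + ‖ξ‖) ^ (p + k) := by
  rw [Complex.norm_real, norm_mul, norm_pow, pow_add, ← mul_assoc]
  have hi : ‖ξ i‖ ≤ 1 + ‖ξ‖ := (norm_le_pi_norm ξ i).trans (by simp)
  exact mul_le_mul (hM ξ) (pow_le_pow_left₀ (norm_nonneg _) hi k) (by positivity)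
    ((abs_nonneg _).trans (hM ξ))

lemma integral_mul_prod_last_pow_four {m p : ℕ} {M : (Fin (m + 1) → ℝ) → ℝ} {C : ℝ}
    (hMcont : Continuous M) (hM : ∀ ξ, |M ξ| ≤ C * (1 + ‖ξ‖) ^ p) (f : 𝓢(ℝ, ℂ)) :
    ∫ v : Fin m → ℝ,
        ((M (padZero (m + 1) v) * padZero (m + 1) v (Fin.last m) : ℝ) : ℂ) *
        ∏ j, (if j = Fin.last m then (schwartzFTs (schwartzPow f 3) : ℝ → ℂ)
          else schwartzFTs f) (padZero (m + 1) v j) =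
      ((((2 * Real.pi) ^ 3)⁻¹ : ℝ) : ℂ) * Lam (m + 1 + 3)
        (fun ξ => ((M (collapse (m + 1) ξ) *
          (ξ ⟨m + 1 - 1, by omega⟩ + ξ ⟨m + 1, by omega⟩ + ξ ⟨m + 1 + 1, by omega⟩
            + ξ ⟨m + 1 + 2, by omega⟩) : ℝ) : ℂ)) f := by
  set A : (Fin m → ℝ) → ℂ := fun v =>
    ((M (padZero (m + 1) v) * padZero (m + 1) v (Fin.last m) ^ 1 : ℝ) : ℂ) *
      ∏ j, schwartzFTs f (v j) with hA
  have hA0 : Integrable A := integrable_mul_prod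
    (N := fun ξ => ((M ξ * ξ (Fin.last m) ^ 1 : ℝ) : ℂ)) (by fun_prop)
    (norm_mul_pow_le hM (Fin.last m)) fun _ => schwartzFTs f
  have hA1 := integrable_init_mul_last hA0 (schwartzFTs f).integrable
  have hA2 := integrable_init_mul_last hA1 (schwartzFTs f).integrable
  have h0 := integral_mul_schwartzFTs_mul hA0 f (schwartzPow f 2)
  have h1 := integral_mul_schwartzFTs_mul hA1 f (schwartzPow f 1)
  have h2 := integral_mul_schwartzFTs_mul hA2 f (schwartzPow f 0)
  have hL : ∫ v : Fin m → ℝ,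
        ((M (padZero (m + 1) v) * padZero (m + 1) v (Fin.last m) : ℝ) : ℂ) *
        ∏ j, (if j = Fin.last m then (schwartzFTs (schwartzPow f 3) : ℝ → ℂ)
          else schwartzFTs f) (padZero (m + 1) v j) =
      ∫ v, A v * schwartzFTs (schwartzPow f 3) (-∑ i, v i) := by
    refine integral_congr_ae (Filter.Eventually.of_forall fun v => ?_)
    simp only [hA, Fin.prod_univ_castSucc, padZero_castSucc, padZero_last, pow_one, if_true,
      (Fin.castSucc_lt_last _).ne, if_false]
    ring
  rw [hL, show schwartzPow f 3 = SchwartzMap.pairing (ContinuousLinearMap.mul ℂ ℂ) f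
    (schwartzPow f 2) from rfl, h0, show schwartzPow f 2 = SchwartzMap.pairing
    (ContinuousLinearMap.mul ℂ ℂ) f (schwartzPow f 1) from rfl, h1, show schwartzPow f 1 =
    SchwartzMap.pairing (ContinuousLinearMap.mul ℂ ℂ) f (schwartzPow f 0) from rfl, h2,
    ← mul_assoc, ← mul_assoc]
  congr 1
  · push_cast
    ring
  refine integral_congr_ae (Filter.Eventually.of_forall fun (w : Fin (m + 3) → ℝ) => ?_)
  have hsum : padZero (m + 3 + 1) w ⟨m, by omega⟩ + padZero (m + 3 + 1) w ⟨m + 1, by omega⟩ +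
      padZero (m + 3 + 1) w ⟨m + 2, by omega⟩ + padZero (m + 3 + 1) w ⟨m + 3, by omega⟩ =
      -∑ i : Fin m, w i.castSucc.castSucc.castSucc := by
    have h := sum_padZero w
    simp only [Fin.sum_univ_castSucc, padZero_castSucc, padZero_last] at h
    have e0 : padZero (m + 3 + 1) w ⟨m, by omega⟩ = w (Fin.last m).castSucc.castSucc :=
      padZero_castSucc w (Fin.last m).castSucc.castSucc
    have e1 : padZero (m + 3 + 1) w ⟨m + 1, by omega⟩ = w (Fin.last (m + 1)).castSucc :=
      padZero_castSucc w (Fin.last (m + 1)).castSucc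
    have e2 : padZero (m + 3 + 1) w ⟨m + 2, by omega⟩ = w (Fin.last (m + 2)) :=
      padZero_castSucc w (Fin.last (m + 2))
    have e3 : padZero (m + 3 + 1) w ⟨m + 3, by omega⟩ = -∑ i, w i := padZero_last w
    rw [e0, e1, e2, e3]
    simp only [Fin.sum_univ_castSucc]
    ring
  have hcollapse : collapse (m + 1) (padZero (m + 3 + 1) w) =
      padZero (m + 1) fun j => w j.castSucc.castSucc.castSucc := by
    ext j
    refine Fin.lastCases ?_ (fun j => ?_) j
    · rw [padZero_last, ← hsum]
      simp [collapse]
    · rw [padZero_castSucc]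
      have hj : (j.castSucc : ℕ) < m + 1 - 1 := by simp
      rw [collapse, if_pos hj]
      exact padZero_castSucc w j.castSucc.castSucc.castSucc
  change A (fun j => w j.castSucc.castSucc.castSucc) *
      schwartzFTs f (w (Fin.last m).castSucc.castSucc) *
      schwartzFTs f (w (Fin.last (m + 1)).castSucc) * schwartzFTs f (w (Fin.last (m + 2))) *
      schwartzFTs f (-∑ i, w i) =
    ((M (collapse (m + 1) (padZero (m + 3 + 1) w)) *
      (padZero (m + 3 + 1) w ⟨m, by omega⟩ + padZero (m + 3 + 1) w ⟨m + 1, by omega⟩ +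
      padZero (m + 3 + 1) w ⟨m + 2, by omega⟩ + padZero (m + 3 + 1) w ⟨m + 3, by omega⟩) : ℝ) :
      ℂ) * ∏ j : Fin (m + 3 + 1), FTs f (padZero (m + 3 + 1) w j)
  rw [hcollapse, hsum]
  simp only [← schwartzFTs_apply]
  rw [Fin.prod_univ_castSucc, Fin.prod_univ_castSucc, Fin.prod_univ_castSucc,
    Fin.prod_univ_castSucc]
  simp only [hA, padZero_castSucc, padZero_last, pow_one, mul_assoc]
  rfl

lemma integral_mul_prod_quarticKdV {m p : ℕ} {M : (Fin (m + 1) → ℝ) → ℝ} {C : ℝ}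
    (hMcont : Continuous M) (hM : ∀ ξ, |M ξ| ≤ C * (1 + ‖ξ‖) ^ p) {F G dF : 𝓢(ℝ, ℂ)}
    (hdF : ∀ ξ : ℝ, dF ξ = Complex.I * ξ ^ 3 * F ξ + Complex.I * ξ * G ξ) (i : Fin (m + 1)) :
    ∫ v : Fin m → ℝ, (M (padZero (m + 1) v) : ℂ) *
        ∏ j, (if j = i then dF else F) (padZero (m + 1) v j) =
      Complex.I * (∫ v : Fin m → ℝ,
        ((M (padZero (m + 1) v) * padZero (m + 1) v i ^ 3 : ℝ) : ℂ) *
          ∏ j, F (padZero (m + 1) v j)) +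
      Complex.I * ∫ v : Fin m → ℝ,
        ((M (padZero (m + 1) v) * padZero (m + 1) v i : ℝ) : ℂ) *
          ∏ j, (if j = i then (G : ℝ → ℂ) else F) (padZero (m + 1) v j) := by
  have hI1 := integrable_mul_prod_padZero (N := fun ξ => ((M ξ * ξ i ^ 3 : ℝ) : ℂ))
    (by fun_prop) (norm_mul_pow_le hM i) fun _ => F
  have hI2 := integrable_mul_prod_padZero (N := fun ξ => ((M ξ * ξ i ^ 1 : ℝ) : ℂ))
    (by fun_prop) (norm_mul_pow_le hM i) fun j => if j = i then G else F
  have hcoe : ∀ (j : Fin (m + 1)) (x : ℝ),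
      (if j = i then (G : ℝ → ℂ) else F) x = (if j = i then G else F) x := fun j x => by
    split_ifs <;> rfl
  simp only [pow_one] at hI2
  simp only [hcoe]
  rw [← integral_const_mul, ← integral_const_mul,
    ← integral_add (hI1.const_mul _) (hI2.const_mul _)]
  refine integral_congr_ae (Filter.Eventually.of_forall fun v => ?_)
  have hsplit : ∀ H : 𝓢(ℝ, ℂ), ∏ j, (if j = i then H else F) (padZero (m + 1) v j) =
      H (padZero (m + 1) v i) * ∏ j ∈ Finset.univ.erase i, F (padZero (m + 1) v j) := fun H => by
    rw [← Finset.mul_prod_erase _ _ (Finset.mem_univ i), if_pos rfl]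
    congr 1
    refine Finset.prod_congr rfl fun j hj => ?_
    rw [if_neg (Finset.ne_of_mem_erase hj)]
  have hF := Finset.mul_prod_erase Finset.univ (fun j => F (padZero (m + 1) v j))
    (Finset.mem_univ i)
  simp only [hsplit, hdF, ← hF]
  push_cast
  ring

theorem quartic_kdv_Lambda_derivative
    (n : ℕ) (hn : 2 ≤ n)
    (M : (Fin n → ℝ) → ℝ)
    (hMcont : Continuous M)
    (hMsymm : ∀ (σ : Equiv.Perm (Fin n)) (ξ : Fin n → ℝ), M (ξ ∘ σ) = M ξ)
    (hMpoly : ∃ (C : ℝ) (p : ℕ), ∀ ξ, |M ξ| ≤ C * (1 + ‖ξ‖) ^ p)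
    -- u is a C¹ curve of real-valued Schwartz functions, with derivative du
    (u du : ℝ → SchwartzMap ℝ ℝ)
    (huderiv : ∀ t : ℝ, Filter.Tendsto (fun h : ℝ => h⁻¹ • (u (t + h) - u t))
      (nhdsWithin 0 {0}ᶜ) (nhds (du t)))
    (hducont : Continuous du)
    -- u solves ∂_t u + ∂_x³ u = ∂_x (u⁴)
    (hPDE : ∀ t x : ℝ, du t x + iteratedDeriv 3 (⇑(u t)) x
      = deriv (fun y => (u t) y ^ 4) x)
    (t : ℝ) :
    HasDerivAt (fun τ => Lam n (fun ξ => (M ξ : ℂ)) (fun x => ((u τ) x : ℂ)))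
      (Complex.I * Lam n (fun ξ => ((M ξ * ∑ j, (ξ j) ^ 3 : ℝ) : ℂ))
          (fun x => ((u t) x : ℂ))
        + Complex.I * (n : ℂ) * ((((2 * Real.pi) ^ 3)⁻¹ : ℝ) : ℂ) *
          Lam (n + 3)
            (fun ξ => ((M (collapse n ξ) *
              (ξ ⟨n - 1, by omega⟩ + ξ ⟨n, by omega⟩ + ξ ⟨n + 1, by omega⟩
                + ξ ⟨n + 2, by omega⟩) : ℝ) : ℂ))
            (fun x => ((u t) x : ℂ))) t := by
  obtain ⟨m, rfl⟩ : ∃ m, n = m + 1 := ⟨n - 1, by omega⟩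
  obtain ⟨C, p, hM⟩ := hMpoly
  have hFTs : ∀ τ ξ, FTs (fun x => ((u τ) x : ℂ)) ξ = schwartzFTs (complexify (u τ)) ξ :=
    fun τ ξ => (schwartzFTs_apply (complexify (u τ)) ξ).symm
  have hG : Continuous (schwartzFTs.comp complexify) := (schwartzFTs.comp complexify).continuous
  have hderiv := hasDerivAt_integral_mul_prod_padZero (N := fun ξ => (M ξ : ℂ)) (C := C) (p := p)
    (by fun_prop) (fun ξ => by simpa using hM ξ)
    (hG.comp (continuous_of_tendsto_slope huderiv)) (hG.comp hducont)
    (fun s x => hasDerivAt_schwartz_apply (G := schwartzFTs.comp complexify) (huderiv s) x) t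
  have hI := fun i : Fin (m + 1) =>
    integrable_mul_prod_padZero (N := fun ξ => ((M ξ * ξ i ^ 3 : ℝ) : ℂ))
      (by fun_prop) (norm_mul_pow_le hM i) fun _ => schwartzFTs (complexify (u t))
  have hcubic : ∑ i : Fin (m + 1), ∫ v : Fin m → ℝ,
      ((M (padZero (m + 1) v) * padZero (m + 1) v i ^ 3 : ℝ) : ℂ) *
        ∏ j, schwartzFTs (complexify (u t)) (padZero (m + 1) v j) =
      Lam (m + 1) (fun ξ => ((M ξ * ∑ j, (ξ j) ^ 3 : ℝ) : ℂ)) (fun x => ((u t) x : ℂ)) := by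
    rw [← integral_finsetSum _ fun i _ => hI i]
    refine integral_congr_ae (Filter.Eventually.of_forall fun v => ?_)
    simp only [hFTs]
    rw [← Finset.sum_mul, Finset.mul_sum, Complex.ofReal_sum]
  have hquartic := integral_mul_prod_last_pow_four hMcont hM (complexify (u t))
  have hterm := fun i : Fin (m + 1) => integral_mul_prod_quarticKdV hMcont hM
    (schwartzFTs_of_quarticKdV (hPDE t)) i
  have hLam : (fun τ => Lam (m + 1) (fun ξ => (M ξ : ℂ)) (fun x => ((u τ) x : ℂ))) =
      fun τ => ∫ v : Fin m → ℝ, (M (padZero (m + 1) v) : ℂ) *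
        ∏ j, schwartzFTs (complexify (u τ)) (padZero (m + 1) v j) := by
    ext τ
    simp only [Lam, hFTs]
    rfl
  rw [hLam]
  refine hderiv.congr_deriv ((Finset.sum_congr rfl fun i _ => hterm i).trans ?_)
  rw [Finset.sum_add_distrib, ← Finset.mul_sum, ← Finset.mul_sum, hcubic]
  congr 1
  simp only [integral_mul_prod_slot_eq_last hMsymm]
  rw [hquartic, Finset.sum_const, Finset.card_univ, Fintype.card_fin, nsmul_eq_mul,
    ← mul_assoc, ← mul_assoc]
  rfl

end
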